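/- arXiv:2503.10714 — 2 statements merged into one kernel-verified Lean document; each statement's English description precedes it below -/
import Mathlib

section
/- Let d be a positive natural number, let q ∈ ℝ^d be a query vector, and let k_1, …, k_T ∈ ℝ^d be key vectors with pre-softmax logits s_t = ⟪q, k_t⟫/√d. Suppose the index set {1, …, T} is partitioned into a set U of uncompressed tokens and finitely many disjoint nonempty residual groups G_1, …, G_R ⊆ {1, …, T} ∖ U whose union is {1, …, T} ∖ U. For each group G_r with size w_r = |G_r|, let k̄_r = (1/w_r) ∑_{m ∈ G_r} k_m be the merged key and let α ∈ (0, 1]. Then the revised softmax denominator satisfies ∑_{t ∈ U} exp(s_t) + ∑_{r=1}^{R} exp(⟪q, k̄_r⟫/√d + α · log w_r) ≤ ∑_{t=1}^{T} exp(s_t). -/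
open Finset RealInnerProductSpace in
theorem zeromerge_compressed_partition_function_le
    (d T R : ℕ) (hd : 0 < d)
    (q : EuclideanSpace ℝ (Fin d)) (k : Fin T → EuclideanSpace ℝ (Fin d))
    (s : Fin T → ℝ) (hs : ∀ t, s t = ⟪q, k t⟫ / Real.sqrt d)
    (U : Finset (Fin T)) (G : Fin R → Finset (Fin T))
    (hGne : ∀ r, (G r).Nonempty)
    (hGdisj : ∀ r r', r ≠ r' → Disjoint (G r) (G r'))
    (hGsub : ∀ r, G r ⊆ Uᶜ)
    (hGcover : (Finset.univ.biUnion G) = Uᶜ)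
    (w : Fin R → ℕ) (hw : ∀ r, w r = (G r).card)
    (kbar : Fin R → EuclideanSpace ℝ (Fin d))
    (hkbar : ∀ r, kbar r = ((w r : ℝ)⁻¹) • ∑ m ∈ G r, k m)
    (α : ℝ) (hα0 : 0 < α) (hα1 : α ≤ 1) :
    ∑ t ∈ U, Real.exp (s t)
      + ∑ r, Real.exp (⟪q, kbar r⟫ / Real.sqrt d + α * Real.log (w r))
      ≤ ∑ t, Real.exp (s t) := by
  rw [← Finset.sum_add_sum_compl U, ← hGcover,
    Finset.sum_biUnion (fun r _ r' _ h => hGdisj r r' h)]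
  refine add_le_add le_rfl (Finset.sum_le_sum fun r _ => ?_)
  have hc : 0 < (G r).card := (hGne r).card_pos
  have hw1 : (1 : ℝ) ≤ w r := by
    rw [hw r]
    exact_mod_cast hc
  have hw0 : (0 : ℝ) < w r := by linarith
  have hmean : ⟪q, kbar r⟫ / Real.sqrt d = ∑ m ∈ G r, (w r : ℝ)⁻¹ • s m := by
    rw [hkbar, real_inner_smul_right, inner_sum, ← Finset.smul_sum, smul_eq_mul, mul_div_assoc,
      Finset.sum_div]
    simp only [hs]
  have hJ := convexOn_exp.map_sum_le (t := G r) (w := fun _ => (w r : ℝ)⁻¹) (p := s)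
    (fun _ _ => by positivity)
    (by
      rw [Finset.sum_const, nsmul_eq_mul, ← hw r]
      exact mul_inv_cancel₀ hw0.ne')
    (fun _ _ => Set.mem_univ _)
  rw [← hmean, ← Finset.smul_sum, smul_eq_mul] at hJ
  have hlog : α * Real.log (w r) ≤ Real.log (w r) := by
    have := Real.log_nonneg hw1
    nlinarith
  calc Real.exp (⟪q, kbar r⟫ / Real.sqrt d + α * Real.log (w r))
      ≤ Real.exp (⟪q, kbar r⟫ / Real.sqrt d + Real.log (w r)) := by gcongr
    _ = Real.exp (⟪q, kbar r⟫ / Real.sqrt d) * w r := by rw [Real.exp_add, Real.exp_log hw0]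
    _ ≤ ((w r : ℝ)⁻¹ * ∑ m ∈ G r, Real.exp (s m)) * w r := by gcongr
    _ = ∑ m ∈ G r, Real.exp (s m) := by field_simp
end

section
/- Let d be a positive natural number, let q ∈ ℝ^d be a query vector, and let k_1, …, k_T ∈ ℝ^d be key vectors with pre-softmax logits s_t = ⟪q, k_t⟫/√d. Suppose the index set {1, …, T} is partitioned into a set U of uncompressed tokens and finitely many disjoint nonempty residual groups G_1, …, G_R ⊆ {1, …, T} ∖ U whose union is {1, …, T} ∖ U. For each group G_r with size w_r = |G_r|, let k̄_r = (1/w_r) ∑_{m ∈ G_r} k_m be the merged key and let α ∈ (0, 1]. Define the original attention score of token i as a_i = exp(s_i) / ∑_{t=1}^{T} exp(s_t), and the revised attention score of an uncompressed token i ∈ U as â_i = exp(s_i) / ( ∑_{t ∈ U} exp(s_t) + ∑_{r=1}^{R} exp(⟪q, k̄_r⟫/√d + α · log w_r) ). Then for every uncompressed token i ∈ U, â_i ≥ a_i. -/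
open Finset RealInnerProductSpace in
theorem zeromerge_main_attention_preservation
    (d T R : ℕ) (hd : 0 < d)
    (q : EuclideanSpace ℝ (Fin d)) (k : Fin T → EuclideanSpace ℝ (Fin d))
    (s : Fin T → ℝ) (hs : ∀ t, s t = ⟪q, k t⟫ / Real.sqrt d)
    (U : Finset (Fin T)) (G : Fin R → Finset (Fin T))
    (hGne : ∀ r, (G r).Nonempty)
    (hGdisj : ∀ r r', r ≠ r' → Disjoint (G r) (G r'))
    (hGsub : ∀ r, G r ⊆ Uᶜ)
    (hGcover : (Finset.univ.biUnion G) = Uᶜ)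
    (w : Fin R → ℕ) (hw : ∀ r, w r = (G r).card)
    (kbar : Fin R → EuclideanSpace ℝ (Fin d))
    (hkbar : ∀ r, kbar r = ((w r : ℝ)⁻¹) • ∑ m ∈ G r, k m)
    (α : ℝ) (hα0 : 0 < α) (hα1 : α ≤ 1)
    (a ahat : Fin T → ℝ)
    (ha : ∀ i, a i = Real.exp (s i) / ∑ t, Real.exp (s t))
    (hahat : ∀ i, ahat i = Real.exp (s i) /
      (∑ t ∈ U, Real.exp (s t)
        + ∑ r, Real.exp (⟪q, kbar r⟫ / Real.sqrt d + α * Real.log (w r)))) :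
    ∀ i ∈ U, a i ≤ ahat i := by
  intro i hi
  rw [ha, hahat]
  have key : ∀ r, Real.exp (⟪q, kbar r⟫ / Real.sqrt d + α * Real.log (w r))
      ≤ ∑ t ∈ G r, Real.exp (s t) := by
    intro r
    have hwpos : 0 < w r := by rw [hw]; exact (hGne r).card_pos
    have hw1 : (1 : ℝ) ≤ w r := by exact_mod_cast hwpos
    have hw0 : (0 : ℝ) < w r := by linarith
    have hlog : 0 ≤ Real.log (w r) := Real.log_nonneg hw1
    have hmean : ⟪q, kbar r⟫ / Real.sqrt d = ∑ m ∈ G r, (w r : ℝ)⁻¹ • s m := by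
      rw [hkbar, inner_smul_right, inner_sum, mul_div_assoc, Finset.sum_div, Finset.mul_sum]
      exact Finset.sum_congr rfl fun m _ => by rw [hs, smul_eq_mul]
    have hj : Real.exp (∑ m ∈ G r, (w r : ℝ)⁻¹ • s m)
        ≤ ∑ m ∈ G r, (w r : ℝ)⁻¹ • Real.exp (s m) := by
      refine convexOn_exp.map_sum_le (fun _ _ => by positivity) ?_ (fun _ _ => Set.mem_univ _)
      rw [Finset.sum_const, ← hw, nsmul_eq_mul, mul_inv_cancel₀ hw0.ne']
    calc Real.exp (⟪q, kbar r⟫ / Real.sqrt d + α * Real.log (w r))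
        ≤ Real.exp (⟪q, kbar r⟫ / Real.sqrt d + Real.log (w r)) := by
          apply Real.exp_le_exp.mpr
          nlinarith
      _ = Real.exp (∑ m ∈ G r, (w r : ℝ)⁻¹ • s m) * w r := by
          rw [Real.exp_add, Real.exp_log hw0, hmean]
      _ ≤ (∑ m ∈ G r, (w r : ℝ)⁻¹ • Real.exp (s m)) * w r := by gcongr
      _ = ∑ t ∈ G r, Real.exp (s t) := by
          rw [← Finset.smul_sum, smul_eq_mul]
          field_simp
  have hsplit : ∑ t, Real.exp (s t)
      = ∑ t ∈ U, Real.exp (s t) + ∑ r, ∑ t ∈ G r, Real.exp (s t) := by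
    rw [← Finset.sum_add_sum_compl U, ← hGcover, Finset.sum_biUnion]
    intro r _ r' _ h
    exact hGdisj r r' h
  have hU : 0 < ∑ t ∈ U, Real.exp (s t) :=
    Finset.sum_pos (fun _ _ => Real.exp_pos _) ⟨i, hi⟩
  have hM : 0 ≤ ∑ r, Real.exp (⟪q, kbar r⟫ / Real.sqrt d + α * Real.log (w r)) :=
    Finset.sum_nonneg fun _ _ => (Real.exp_pos _).le
  apply div_le_div_of_nonneg_left (Real.exp_pos _).le (by linarith)
  rw [hsplit]
  have := Finset.sum_le_sum (s := Finset.univ) fun r _ => key r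
  linarith
end
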